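/- arXiv:1601.07359 — 4 statements merged into one kernel-verified Lean document; each statement's English description precedes it below -/
import Mathlib

section
/- Let (g, h) be a semisimple symmetric pair with commuting involutions σ and θ as below, Σ its restricted root system, and assume (g, h) is basic. Then for every signature ε of Σ, the inequality dim(k ∩ h) ≥ dim(k ∩ h_ε) holds; moreover, equality holds if and only if the pair (g, h_ε) is also basic. -/
/-!
Statement 9: for a basic semisimple symmetric pair `(g, h)` and a signature `ε` of its
restricted root system, `dim(k ∩ h) ≥ dim(k ∩ h_ε)`, with equality iff `(g, h_ε)` is basic.
-/

noncomputable section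

variable {L : Type*} [LieRing L] [LieAlgebra ℝ L]

/-- The fixed point set `ker (f − id)` of a linear endomorphism, as a submodule. -/
def fixedSet (f : L →ₗ[ℝ] L) : Submodule ℝ L :=
  LinearMap.ker (f - LinearMap.id)

/-- The `(−1)`-eigenspace `ker (f + id)` of a linear endomorphism, as a submodule. -/
def negFixedSet (f : L →ₗ[ℝ] L) : Submodule ℝ L :=
  LinearMap.ker (f + LinearMap.id)

/-- `f` is an involutive automorphism of the Lie algebra `L`. -/
def IsInvolutiveLieAut (f : L →ₗ[ℝ] L) : Prop :=
  (∀ X Y : L, f ⁅X, Y⁆ = ⁅f X, f Y⁆) ∧ ∀ X : L, f (f X) = X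

/-- `θ` is a Cartan involution of the real Lie algebra `L` with Killing form `B`: an
involutive automorphism such that `(X,Y) ↦ −B(X, θY)` is positive definite. -/
def IsCartanInvolution [Module.Finite ℝ L] (θ : L →ₗ[ℝ] L) : Prop :=
  IsInvolutiveLieAut θ ∧
    (∀ X Y : L, -(killingForm ℝ L) X (θ Y) = -(killingForm ℝ L) Y (θ X)) ∧
    ∀ X : L, X ≠ 0 → 0 < -(killingForm ℝ L) X (θ X)

/-- `a` is a maximal abelian subspace of the subspace `W` of `L`. -/
def IsMaxAbelianSubspaceOf (W a : Submodule ℝ L) : Prop :=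
  a ≤ W ∧ (∀ X ∈ a, ∀ Y ∈ a, ⁅X, Y⁆ = (0 : L)) ∧
    ∀ a' : Submodule ℝ L, a' ≤ W → (∀ X ∈ a', ∀ Y ∈ a', ⁅X, Y⁆ = (0 : L)) → a ≤ a' → a' = a

/-- The root space `g_α = {X ∈ L : [Y,X] = α(Y)·X for all Y ∈ a}` for a linear functional
`α` on the subspace `a`. -/
def rootSpace' (a : Submodule ℝ L) (α : Module.Dual ℝ a) : Submodule ℝ L :=
  ⨅ Y : a, LinearMap.ker (((LieAlgebra.ad ℝ L) (Y : L)) - α Y • LinearMap.id)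

/-- The restricted root system `Σ = {α ∈ a* ∖ {0} : g_α ≠ 0}`. -/
def restrictedRoots (a : Submodule ℝ L) : Set (Module.Dual ℝ a) :=
  {α | α ≠ 0 ∧ rootSpace' a α ≠ ⊥}

/-- The multiplicity `m⁺(α) = dim` of the `(+1)`-eigenspace of `τ` (which will be `θσ`)
on the root space `g_α`. -/
noncomputable def mPlus (a : Submodule ℝ L) (τ : L →ₗ[ℝ] L) (α : Module.Dual ℝ a) : ℕ :=
  Module.finrank ℝ (rootSpace' a α ⊓ fixedSet τ : Submodule ℝ L)

/-- The multiplicity `m⁻(α) = dim` of the `(−1)`-eigenspace of `τ` (which will be `θσ`)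
on the root space `g_α`. -/
noncomputable def mMinus (a : Submodule ℝ L) (τ : L →ₗ[ℝ] L) (α : Module.Dual ℝ a) : ℕ :=
  Module.finrank ℝ (rootSpace' a α ⊓ negFixedSet τ : Submodule ℝ L)

/-- The symmetric pair determined by the commuting involutions `σ` (defining the pair) and
`θ` (a Cartan involution), with maximal abelian subspace `a ⊆ p ∩ q`, is basic:
`m⁺(α) ≥ m⁻(α)` (eigenspace dimensions of `θσ` on `g_α`) for every restricted root `α`
with `α/2` not a restricted root. -/
def IsBasicPair (σ θ : L →ₗ[ℝ] L) (a : Submodule ℝ L) : Prop :=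
  ∀ α ∈ restrictedRoots a, ((2⁻¹ : ℝ) • α) ∉ restrictedRoots a →
    mMinus a (θ ∘ₗ σ) α ≤ mPlus a (θ ∘ₗ σ) α

/-- `ε` is a signature of the set `S` of restricted roots: it takes values `±1` on `S`,
satisfies `ε(−α) = ε(α)`, and is multiplicative on `S`. -/
def IsSignatureOn {a : Submodule ℝ L} (S : Set (Module.Dual ℝ a))
    (ε : Module.Dual ℝ a → ℝ) : Prop :=
  (∀ α ∈ S, ε α = 1 ∨ ε α = -1) ∧ (∀ α ∈ S, -α ∈ S → ε (-α) = ε α) ∧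
    ∀ α ∈ S, ∀ β ∈ S, α + β ∈ S → ε (α + β) = ε α * ε β

/-- `σε` is the involution `σ_ε` attached to the signature `ε`: it agrees with `σ` on the
centralizer `z_g(a) = g_0` and with `ε(α)·σ` on each restricted root space `g_α`. -/
def IsSigmaEps (σ : L →ₗ[ℝ] L) (a : Submodule ℝ L) (ε : Module.Dual ℝ a → ℝ)
    (σε : L →ₗ[ℝ] L) : Prop :=
  (∀ X ∈ rootSpace' a 0, σε X = σ X) ∧
    ∀ α ∈ restrictedRoots a, ∀ X ∈ rootSpace' a α, σε X = ε α • σ X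

/-! ### Helper lemmas -/

theorem aux_top_indep {V : Type*} [AddCommGroup V] [Module ℝ V] [FiniteDimensional ℝ V]
    (B : V →ₗ[ℝ] V →ₗ[ℝ] ℝ) (hs : ∀ x y, B x y = B y x) (hp : ∀ x, x ≠ 0 → 0 < B x x)
    {ι : Type*} (T : ι → V →ₗ[ℝ] V) (hT : ∀ i x y, B (T i x) y = B x (T i y))
    (hc : ∀ i j, Commute (T i) (T j)) :
    (⨆ χ : ι → ℝ, ⨅ i, Module.End.eigenspace (T i) (χ i)) = ⊤ ∧
      iSupIndep (fun χ : ι → ℝ => ⨅ i, Module.End.eigenspace (T i) (χ i)) := by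
  let core : InnerProductSpace.Core ℝ V :=
    { inner := fun x y => B x y
      conj_inner_symm := fun x y => by simpa using hs y x
      re_inner_nonneg := fun x => by
        by_cases h : x = 0
        · simp [h]
        · simpa using (hp x h).le
      add_left := fun x y z => by simp
      smul_left := fun x y r => by simp
      definite := fun x hx => by
        by_contra h
        exact (hp x h).ne' hx }
  let : NormedAddCommGroup V := core.toNormedAddCommGroup
  let : InnerProductSpace ℝ V := InnerProductSpace.ofCore core.toCore
  have hT' : ∀ i, (T i).IsSymmetric := fun i x y => hT i x y
  exact ⟨LinearMap.IsSymmetric.iSup_iInf_eq_top_of_commute hT' (fun i j _ => hc i j),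
    (LinearMap.IsSymmetric.orthogonalFamily_iInf_eigenspaces hT').independent⟩

theorem mem_rootSpace'_iff (a : Submodule ℝ L) (α : Module.Dual ℝ a) (X : L) :
    X ∈ rootSpace' a α ↔ ∀ Y : a, ⁅(Y : L), X⁆ = α Y • X := by
  simp [rootSpace', Submodule.mem_iInf, sub_eq_zero]

theorem mem_fixedSet_iff (f : L →ₗ[ℝ] L) (X : L) : X ∈ fixedSet f ↔ f X = X := by
  simp [fixedSet, sub_eq_zero]

theorem mem_negFixedSet_iff (f : L →ₗ[ℝ] L) (X : L) : X ∈ negFixedSet f ↔ f X = -X := by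
  simp [negFixedSet, add_eq_zero_iff_eq_neg]

/-- The root space decomposition. -/
theorem rootSpace_top_indep [FiniteDimensional ℝ L] (θ : L →ₗ[ℝ] L) (hθ : IsCartanInvolution θ)
    (a : Submodule ℝ L) (ha : a ≤ negFixedSet θ) (hab : ∀ X ∈ a, ∀ Y ∈ a, ⁅X, Y⁆ = (0 : L)) :
    (⨆ α, rootSpace' a α) = ⊤ ∧ iSupIndep (rootSpace' a) := by
  obtain ⟨⟨hbr, hinv⟩, hsym, hpos⟩ := hθ
  let B : L →ₗ[ℝ] L →ₗ[ℝ] ℝ := -((killingForm ℝ L).compl₂ θ)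
  have hB : ∀ x y, B x y = -(killingForm ℝ L) x (θ y) := fun x y => by simp [B]
  let T : a → L →ₗ[ℝ] L := fun Y => LieAlgebra.ad ℝ L (Y : L)
  have key := aux_top_indep B (fun x y => by rw [hB, hB]; exact hsym x y)
    (fun x hx => by rw [hB]; exact hpos x hx) T
    (fun Y x y => by
      have hY : θ (Y : L) = -(Y : L) := (mem_negFixedSet_iff θ _).1 (ha Y.2)
      rw [hB, hB]
      have h1 := LieModule.traceForm_apply_lie_apply' ℝ L L (Y : L) x (θ y)
      change -(LieModule.traceForm ℝ L L) ⁅(Y : L), x⁆ (θ y)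
        = -(LieModule.traceForm ℝ L L) x (θ ⁅(Y : L), y⁆)
      rw [h1, hbr, hY, neg_lie, map_neg])
    (fun Y Z => by
      apply LinearMap.ext
      intro x
      have h0 : ⁅(Y : L), (Z : L)⁆ = 0 := hab _ Y.2 _ Z.2
      have h1 := leibniz_lie (Y : L) (Z : L) x
      rw [h0, zero_lie, zero_add] at h1
      simpa [T] using h1)
  have hmem : ∀ (χ : a → ℝ) (X : L), X ∈ (⨅ i, Module.End.eigenspace (T i) (χ i)) ↔
      ∀ Y : a, ⁅(Y : L), X⁆ = χ Y • X := by
    intro χ X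
    simp [Submodule.mem_iInf, T, Module.End.mem_eigenspace_iff]
  have heq : ∀ α : Module.Dual ℝ a,
      rootSpace' a α = ⨅ i, Module.End.eigenspace (T i) ((fun Y => α Y) i) := by
    intro α
    ext X
    rw [hmem, mem_rootSpace'_iff]
  constructor
  · rw [eq_top_iff, ← key.1]
    apply iSup_le
    intro χ
    by_cases hbot : (⨅ i, Module.End.eigenspace (T i) (χ i)) = ⊥
    · rw [hbot]; exact bot_le
    · obtain ⟨X, hX, hX0⟩ := Submodule.exists_mem_ne_zero_of_ne_bot hbot
      rw [hmem] at hX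
      let α : Module.Dual ℝ a :=
        { toFun := χ
          map_add' := fun Y Z => by
            apply smul_left_injective ℝ hX0
            have := hX (Y + Z)
            simp only [Submodule.coe_add, add_lie, hX Y, hX Z] at this
            simp only [add_smul]
            exact this.symm
          map_smul' := fun r Y => by
            apply smul_left_injective ℝ hX0
            have := hX (r • Y)
            simp only [Submodule.coe_smul, smul_lie, hX Y] at this
            simp only [smul_eq_mul, mul_smul, RingHom.id_apply]
            exact this.symm }
      have := heq α
      refine le_trans (le_of_eq ?_) (le_iSup _ α)
      rw [this]
      rfl
  · have := key.2.comp (f := fun α : Module.Dual ℝ a => fun Y => α Y)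
      (fun α β h => LinearMap.ext fun Y => congrFun h Y)
    convert this using 1
    funext α
    exact heq α

/-- Dimension of the common fixed space of two commuting involutions. -/
theorem four_finrank [FiniteDimensional ℝ L] (θ σ : L →ₗ[ℝ] L) (hθ : ∀ X, θ (θ X) = X)
    (hσ : ∀ X, σ (σ X) = X) (hc : ∀ X, θ (σ X) = σ (θ X)) :
    4 * (Module.finrank ℝ (fixedSet θ ⊓ fixedSet σ : Submodule ℝ L) : ℝ) =
      LinearMap.trace ℝ L LinearMap.id + LinearMap.trace ℝ L θ + LinearMap.trace ℝ L σ +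
        LinearMap.trace ℝ L (θ ∘ₗ σ) := by
  let P : L →ₗ[ℝ] L := (4⁻¹ : ℝ) • (LinearMap.id + θ + σ + θ ∘ₗ σ)
  have hP : LinearMap.IsProj (fixedSet θ ⊓ fixedSet σ : Submodule ℝ L) P := by
    constructor
    · intro x
      rw [Submodule.mem_inf, mem_fixedSet_iff, mem_fixedSet_iff]
      simp only [P, LinearMap.smul_apply, LinearMap.add_apply, LinearMap.id_apply,
        LinearMap.comp_apply, map_smul, map_add, hθ, hσ, hc]
      constructor <;> · congr 1; abel
    · rintro x ⟨h1, h2⟩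
      have h1 := (mem_fixedSet_iff _ _).1 h1
      have h2 := (mem_fixedSet_iff _ _).1 h2
      simp only [P, LinearMap.smul_apply, LinearMap.add_apply, LinearMap.id_apply,
        LinearMap.comp_apply, h1, h2]
      module
  have := hP.trace
  rw [← this]
  simp only [P, map_smul, map_add, smul_eq_mul]
  ring

/-- The trace of an involution on an invariant subspace. -/
theorem trace_restrict_involution [FiniteDimensional ℝ L] (W : Submodule ℝ L) (τ f : L →ₗ[ℝ] L)
    (hτ : ∀ X, τ (τ X) = X) (hW : Set.MapsTo τ W W) (hf : Set.MapsTo f W W) (c : ℝ)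
    (hfc : ∀ X ∈ W, f X = c • τ X) :
    LinearMap.trace ℝ W (f.restrict hf) =
      c * ((Module.finrank ℝ (W ⊓ fixedSet τ : Submodule ℝ L) : ℝ) -
      (Module.finrank ℝ (W ⊓ negFixedSet τ : Submodule ℝ L) : ℝ)) := by
  let g : W →ₗ[ℝ] W := τ.restrict hW
  have hg : ∀ x, g (g x) = x := fun x => Subtype.ext (hτ x)
  have hfg : f.restrict hf = c • g := by
    ext x
    exact hfc x x.2
  let P : W →ₗ[ℝ] W := (2⁻¹ : ℝ) • (LinearMap.id + g)
  let Q : W →ₗ[ℝ] W := (2⁻¹ : ℝ) • (LinearMap.id - g)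
  have hP : LinearMap.IsProj ((fixedSet τ).comap W.subtype) P := by
    constructor
    · intro x
      rw [Submodule.mem_comap, mem_fixedSet_iff]
      change ((g (P x) : W) : L) = P x
      congr 1
      simp only [P, LinearMap.smul_apply, LinearMap.add_apply, LinearMap.id_apply,
        map_smul, map_add, hg]
      congr 1; abel
    · intro x hx
      rw [Submodule.mem_comap, mem_fixedSet_iff] at hx
      have hx : g x = x := Subtype.ext hx
      simp only [P, LinearMap.smul_apply, LinearMap.add_apply, LinearMap.id_apply, hx]
      module
  have hQ : LinearMap.IsProj ((negFixedSet τ).comap W.subtype) Q := by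
    constructor
    · intro x
      rw [Submodule.mem_comap, mem_negFixedSet_iff]
      change ((g (Q x) : W) : L) = ((- Q x : W) : L)
      congr 1
      simp only [Q, LinearMap.smul_apply, LinearMap.sub_apply, LinearMap.id_apply,
        map_smul, map_sub, hg]
      module
    · intro x hx
      rw [Submodule.mem_comap, mem_negFixedSet_iff] at hx
      have hx : g x = -x := Subtype.ext hx
      simp only [Q, LinearMap.smul_apply, LinearMap.sub_apply, LinearMap.id_apply, hx]
      module
  have e : ∀ S : Submodule ℝ L, Module.finrank ℝ (S.comap W.subtype) =
      Module.finrank ℝ (W ⊓ S : Submodule ℝ L) := by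
    intro S
    rw [← Submodule.map_comap_subtype]
    exact (Submodule.finrank_map_subtype_eq W _).symm
  rw [← e, ← e, ← hP.trace, ← hQ.trace, hfg]
  simp only [P, Q, map_smul, map_add, map_sub, smul_eq_mul]
  ring

/-- Let `g` be a finite-dimensional real semisimple Lie algebra, `σ` an
involutive automorphism, `θ` a Cartan involution commuting with `σ`, with
`h = g^σ`, `q = g^{−σ}`, `k = g^θ`, `p = g^{−θ}`, and let `a` be a maximal abelian subspace
of `p ∩ q`.  Assume that `(g,h)` is basic.  Then for every signature `ε` of the restricted
root system `Σ` of `(g,h)` and the associated involution `σ_ε` (characterized by agreeing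
with `σ` on `z_g(a)` and with `ε(α)σ` on each root space `g_α`), with `h_ε = g^{σ_ε}`:
`dim(k ∩ h) ≥ dim(k ∩ h_ε)`, and equality holds if and only if `(g, h_ε)` is basic. -/
theorem statement9 {L : Type*} [LieRing L] [LieAlgebra ℝ L] [FiniteDimensional ℝ L]
    [LieAlgebra.IsSemisimple ℝ L]
    (σ θ : L →ₗ[ℝ] L) (hσ : IsInvolutiveLieAut σ) (hθ : IsCartanInvolution θ)
    (hcomm : ∀ X : L, θ (σ X) = σ (θ X))
    (a : Submodule ℝ L)
    (ha : IsMaxAbelianSubspaceOf (negFixedSet θ ⊓ negFixedSet σ) a)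
    (hbasic : IsBasicPair σ θ a)
    (ε : Module.Dual ℝ a → ℝ) (hε : IsSignatureOn (restrictedRoots a) ε)
    (σε : L →ₗ[ℝ] L) (hσε : IsSigmaEps σ a ε σε) :
    Module.finrank ℝ (fixedSet θ ⊓ fixedSet σε : Submodule ℝ L) ≤
        Module.finrank ℝ (fixedSet θ ⊓ fixedSet σ : Submodule ℝ L) ∧
      (Module.finrank ℝ (fixedSet θ ⊓ fixedSet σ : Submodule ℝ L) =
          Module.finrank ℝ (fixedSet θ ⊓ fixedSet σε : Submodule ℝ L) ↔
        IsBasicPair σε θ a) := by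
  classical
  have haθ : a ≤ negFixedSet θ := ha.1.trans inf_le_left
  have haσ : a ≤ negFixedSet σ := ha.1.trans inf_le_right
  obtain ⟨htop, hind⟩ := rootSpace_top_indep θ hθ a haθ ha.2.1
  have hint : DirectSum.IsInternal (rootSpace' a) :=
    DirectSum.isInternal_submodule_of_iSupIndep_of_iSup_eq_top hind htop
  obtain ⟨⟨hθbr, hθθ⟩, -, -⟩ := hθ
  obtain ⟨hσbr, hσσ⟩ := hσ
  have hext : ∀ f g : L →ₗ[ℝ] L, (∀ α, ∀ X ∈ rootSpace' a α, f X = g X) → f = g := by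
    intro f g h
    have h1 : (⊤ : Submodule ℝ L) ≤ LinearMap.eqLocus f g := by
      rw [← htop]
      exact iSup_le fun α X hX => h α X hX
    exact LinearMap.ext fun X => h1 (Submodule.mem_top : X ∈ ⊤)
  have hmapneg : ∀ f : L →ₗ[ℝ] L, (∀ X Y : L, f ⁅X, Y⁆ = ⁅f X, f Y⁆) → a ≤ negFixedSet f →
      ∀ α, ∀ X ∈ rootSpace' a α, f X ∈ rootSpace' a (-α) := by
    intro f hf haf α X hX
    rw [mem_rootSpace'_iff] at hX ⊢
    intro Y
    have hY : f (Y : L) = -(Y : L) := (mem_negFixedSet_iff f _).1 (haf Y.2)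
    have h := congrArg f (hX Y)
    rw [hf, hY, map_smul, neg_lie] at h
    rw [LinearMap.neg_apply, neg_smul, ← h, neg_neg]
  have hθm := hmapneg θ hθbr haθ
  have hσm := hmapneg σ hσbr haσ
  have hroot : ∀ α, ∀ X ∈ rootSpace' a α, X ≠ 0 → α ≠ 0 → α ∈ restrictedRoots a :=
    fun α X hX h0 hα => ⟨hα, fun hb => h0 (by rw [hb] at hX; simpa using hX)⟩
  let e : Module.Dual ℝ a → ℝ := fun α => if α = 0 then 1 else ε α
  have hσe : ∀ α, ∀ X ∈ rootSpace' a α, σε X = e α • σ X := by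
    intro α X hX
    by_cases h0 : X = 0
    · simp [h0]
    by_cases hα : α = 0
    · subst hα
      simp [e, hσε.1 X hX]
    · simp only [e, if_neg hα]
      exact hσε.2 α (hroot α X hX h0 hα) X hX
  have he1 : ∀ α, ∀ X ∈ rootSpace' a α, X ≠ 0 → e α * e α = 1 ∧ e (-α) = e α := by
    intro α X hX h0
    by_cases hα : α = 0
    · simp [e, hα]
    · have hr := hroot α X hX h0 hα
      have hr' : -α ∈ restrictedRoots a := by
        refine hroot (-α) (σ X) (hσm α X hX) ?_ (by simpa using hα)
        intro h
        apply h0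
        rw [← hσσ X, h, map_zero]
      simp only [e, if_neg hα, neg_eq_zero]
      refine ⟨?_, hε.2.1 α hr hr'⟩
      rcases hε.1 α hr with h | h <;> rw [h] <;> norm_num
  have hσεσε : ∀ X, σε (σε X) = X := by
    have : σε ∘ₗ σε = LinearMap.id := by
      apply hext
      intro α X hX
      by_cases h0 : X = 0
      · simp [h0]
      obtain ⟨h1, h2⟩ := he1 α X hX h0
      rw [LinearMap.comp_apply, hσe α X hX, map_smul, hσe _ _ (hσm α X hX), h2, smul_smul, h1,
        one_smul, hσσ, LinearMap.id_apply]
    exact fun X => LinearMap.congr_fun this X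
  have hcommε : ∀ X, θ (σε X) = σε (θ X) := by
    have : θ ∘ₗ σε = σε ∘ₗ θ := by
      apply hext
      intro α X hX
      by_cases h0 : X = 0
      · simp [h0]
      obtain ⟨h1, h2⟩ := he1 α X hX h0
      rw [LinearMap.comp_apply, LinearMap.comp_apply, hσe α X hX, map_smul,
        hσe _ _ (hθm α X hX), h2, hcomm]
    exact fun X => LinearMap.congr_fun this X
  have htrσ : LinearMap.trace ℝ L σ = LinearMap.trace ℝ L σε := by
    rw [← sub_eq_zero, ← map_sub]
    by_cases hD : ∃ β : Module.Dual ℝ a, β ≠ 0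
    · obtain ⟨β, hβ⟩ := hD
      refine LinearMap.trace_eq_zero_of_mapsTo_ne hint (fun α => if α = 0 then β else -α) ?_ ?_
      · intro α
        by_cases hα : α = 0
        · simpa [hα] using hβ
        · simp only [if_neg hα]
          intro h
          apply hα
          have h2 : (2 : ℝ) • α = 0 := by
            rw [two_smul]; nth_rewrite 1 [← h]; simp
          simpa using h2
      · intro α X hX
        have hX : X ∈ rootSpace' a α := hX
        by_cases hα : α = 0
        · have : (σ - σε) X = 0 := by
            subst hα
            rw [LinearMap.sub_apply, hσε.1 X hX, sub_self]
          rw [this]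
          exact Submodule.zero_mem _
        · simp only [if_neg hα]
          change (σ - σε) X ∈ rootSpace' a (-α)
          rw [LinearMap.sub_apply, hσe α X hX]
          exact Submodule.sub_mem _ (hσm α X hX) (Submodule.smul_mem _ _ (hσm α X hX))
    · push Not at hD
      have : σ = σε := by
        apply hext
        intro α X hX
        rw [hD α] at hX
        exact (hσε.1 X hX).symm
      rw [this]; simp
  set τ := θ ∘ₗ σ with hτdef
  set τε := θ ∘ₗ σε with hτεdef
  have hττ : ∀ X, τ (τ X) = X := fun X => by simp [τ, hcomm, hθθ, hσσ]
  have hτm : ∀ α, Set.MapsTo τ (rootSpace' a α) (rootSpace' a α) := by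
    intro α X hX
    have := hθm _ _ (hσm α X hX)
    rw [neg_neg] at this
    exact this
  have hτe : ∀ α, ∀ X ∈ rootSpace' a α, τε X = e α • τ X := by
    intro α X hX
    simp [τ, τε, hσe α X hX]
  have hFc : ∀ α, ∀ X ∈ rootSpace' a α, (τ - τε) X = (1 - e α) • τ X := by
    intro α X hX
    rw [LinearMap.sub_apply, hτe α X hX, sub_smul, one_smul]
  have hFm : ∀ α, Set.MapsTo (τ - τε) (rootSpace' a α) (rootSpace' a α) := by
    intro α X hX
    rw [hFc α X hX]
    exact Submodule.smul_mem _ _ (hτm α hX)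
  have hfin : {α | rootSpace' a α ≠ ⊥}.Finite :=
    WellFoundedGT.finite_ne_bot_of_iSupIndep hind
  have hsum : 4 * ((Module.finrank ℝ (fixedSet θ ⊓ fixedSet σ : Submodule ℝ L) : ℝ) -
      Module.finrank ℝ (fixedSet θ ⊓ fixedSet σε : Submodule ℝ L)) =
      ∑ α ∈ hfin.toFinset, (1 - e α) * ((mPlus a τ α : ℝ) - mMinus a τ α) := by
    rw [mul_sub, four_finrank θ σ hθθ hσσ hcomm, four_finrank θ σε hθθ hσεσε hcommε, htrσ]
    have h1 := LinearMap.trace_eq_sum_trace_restrict' hint hfin hFm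
    rw [map_sub] at h1
    have h2 : ∀ α ∈ hfin.toFinset,
        LinearMap.trace ℝ (rootSpace' a α) ((τ - τε).restrict (hFm α)) =
        (1 - e α) * ((mPlus a τ α : ℝ) - mMinus a τ α) := fun α _ =>
      trace_restrict_involution (rootSpace' a α) τ (τ - τε) hττ (hτm α) (hFm α) _ (hFc α)
    rw [Finset.sum_congr rfl h2] at h1
    rw [← h1]
    ring
  -- a root with `ε = -1` is not twice a root
  have hhalf : ∀ α ∈ restrictedRoots a, ε α = -1 → ((2⁻¹ : ℝ) • α) ∉ restrictedRoots a := by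
    intro α hα h1 h2
    have hadd : (2⁻¹ : ℝ) • α + (2⁻¹ : ℝ) • α = α := by module
    have h3 := hε.2.2 _ h2 _ h2 (by rw [hadd]; exact hα)
    rw [hadd, h1] at h3
    nlinarith [mul_self_nonneg (ε ((2⁻¹ : ℝ) • α))]
  have hnn : ∀ α ∈ hfin.toFinset, 0 ≤ (1 - e α) * ((mPlus a τ α : ℝ) - mMinus a τ α) := by
    intro α hα
    have hα : rootSpace' a α ≠ ⊥ := by simpa using hα
    by_cases h0 : α = 0
    · simp [e, h0]
    have hr : α ∈ restrictedRoots a := ⟨h0, hα⟩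
    simp only [e, if_neg h0]
    rcases hε.1 α hr with h | h
    · simp [h]
    · have := hbasic α hr (hhalf α hr h)
      have : (mMinus a τ α : ℝ) ≤ mPlus a τ α := by exact_mod_cast this
      rw [h]
      linarith
  have hmp : ∀ α ∈ restrictedRoots a, ε α = 1 →
      mPlus a τε α = mPlus a τ α ∧ mMinus a τε α = mMinus a τ α := by
    intro α hr h
    have h' : ∀ X ∈ rootSpace' a α, τε X = τ X := by
      intro X hX
      rw [hτe α X hX]
      simp [e, hr.1, h]
    have e1 : rootSpace' a α ⊓ fixedSet τε = rootSpace' a α ⊓ fixedSet τ := by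
      ext X
      simp only [Submodule.mem_inf, mem_fixedSet_iff]
      exact and_congr_right fun hX => by rw [h' X hX]
    have e2 : rootSpace' a α ⊓ negFixedSet τε = rootSpace' a α ⊓ negFixedSet τ := by
      ext X
      simp only [Submodule.mem_inf, mem_negFixedSet_iff]
      exact and_congr_right fun hX => by rw [h' X hX]
    exact ⟨by rw [mPlus, mPlus, e1], by rw [mMinus, mMinus, e2]⟩
  have hmm : ∀ α ∈ restrictedRoots a, ε α = -1 →
      mPlus a τε α = mMinus a τ α ∧ mMinus a τε α = mPlus a τ α := by
    intro α hr h
    have h' : ∀ X ∈ rootSpace' a α, τε X = -τ X := by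
      intro X hX
      rw [hτe α X hX]
      simp [e, hr.1, h]
    have e1 : rootSpace' a α ⊓ fixedSet τε = rootSpace' a α ⊓ negFixedSet τ := by
      ext X
      simp only [Submodule.mem_inf, mem_fixedSet_iff, mem_negFixedSet_iff]
      exact and_congr_right fun hX => by rw [h' X hX, neg_eq_iff_eq_neg]
    have e2 : rootSpace' a α ⊓ negFixedSet τε = rootSpace' a α ⊓ fixedSet τ := by
      ext X
      simp only [Submodule.mem_inf, mem_fixedSet_iff, mem_negFixedSet_iff]
      exact and_congr_right fun hX => by rw [h' X hX, neg_inj]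
    exact ⟨by rw [mPlus, mMinus, e1], by rw [mMinus, mPlus, e2]⟩
  constructor
  · have := Finset.sum_nonneg hnn
    rw [← hsum] at this
    have h2 : (Module.finrank ℝ (fixedSet θ ⊓ fixedSet σε : Submodule ℝ L) : ℝ) ≤
        Module.finrank ℝ (fixedSet θ ⊓ fixedSet σ : Submodule ℝ L) := by linarith
    exact_mod_cast h2
  · have hiff : Module.finrank ℝ (fixedSet θ ⊓ fixedSet σ : Submodule ℝ L) =
          Module.finrank ℝ (fixedSet θ ⊓ fixedSet σε : Submodule ℝ L) ↔
        ∑ α ∈ hfin.toFinset, (1 - e α) * ((mPlus a τ α : ℝ) - mMinus a τ α) = 0 := by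
      rw [← hsum]
      constructor
      · intro h
        rw [h]; simp
      · intro h
        have h2 : (Module.finrank ℝ (fixedSet θ ⊓ fixedSet σ : Submodule ℝ L) : ℝ) =
          Module.finrank ℝ (fixedSet θ ⊓ fixedSet σε : Submodule ℝ L) := by linarith
        exact_mod_cast h2
    rw [hiff, Finset.sum_eq_zero_iff_of_nonneg hnn]
    constructor
    · intro h α hr hh
      change mMinus a τε α ≤ mPlus a τε α
      rcases hε.1 α hr with h1 | h1
      · rw [(hmp α hr h1).1, (hmp α hr h1).2]
        exact hbasic α hr hh
      · rw [(hmm α hr h1).1, (hmm α hr h1).2]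
        have h2 := h α (by simpa using hr.2)
        simp only [e, if_neg hr.1, h1] at h2
        have h3 : (mPlus a τ α : ℝ) ≤ mMinus a τ α := by linarith
        exact_mod_cast h3
    · intro h α hα
      have hα : rootSpace' a α ≠ ⊥ := by simpa using hα
      by_cases h0 : α = 0
      · simp [e, h0]
      have hr : α ∈ restrictedRoots a := ⟨h0, hα⟩
      simp only [e, if_neg h0]
      rcases hε.1 α hr with h1 | h1
      · simp [h1]
      · have hh := hhalf α hr h1
        have h2 : mMinus a τε α ≤ mPlus a τε α := h α hr hh
        rw [(hmm α hr h1).1, (hmm α hr h1).2] at h2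
        have h3 : mMinus a τ α ≤ mPlus a τ α := hbasic α hr hh
        have h4 : mPlus a τ α = mMinus a τ α := le_antisymm h2 h3
        rw [h4]; simp

end
end

section
/- Let (g, h) be a semisimple symmetric pair with commuting involutions σ and θ as below and Σ its restricted root system. Let ε be a signature of Σ and ε̂ a half-signature of Σ with ε̂² = ε. Then: (1) the automorphism f_ε̂ of the complexification g_ℂ maps the complexification h_ℂ of h onto the complexification (h_ε)_ℂ of h_ε; and (2) h ∩ g_ε̂ = h_ε ∩ g_ε̂. -/
/-!
Statement 10: for a half-signature `ε̂` with `ε̂² = ε`, the automorphism `f_ε̂` of `g_ℂ`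
maps `h_ℂ` onto `(h_ε)_ℂ`, and `h ∩ g_ε̂ = h_ε ∩ g_ε̂`.
-/

open scoped TensorProduct

noncomputable section

variable {L : Type*} [LieRing L] [LieAlgebra ℝ L]

/-- `ε̂` is a half-signature of the set `S` of restricted roots: it takes values in
`{±1, ±√−1} ⊆ ℂ` on `S`, satisfies `ε̂(−α) = ε̂(α)⁻¹`, and is multiplicative on `S`. -/
def IsHalfSignatureOn {L : Type*} [LieRing L] [LieAlgebra ℝ L] {a : Submodule ℝ L}
    (S : Set (Module.Dual ℝ a)) (εh : Module.Dual ℝ a → ℂ) : Prop :=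
  (∀ α ∈ S, εh α = 1 ∨ εh α = -1 ∨ εh α = Complex.I ∨ εh α = -Complex.I) ∧
    (∀ α ∈ S, -α ∈ S → εh (-α) = (εh α)⁻¹) ∧
    ∀ α ∈ S, ∀ β ∈ S, α + β ∈ S → εh (α + β) = εh α * εh β

/-- The set of `X ∈ L` (regarded inside the complexification `ℂ ⊗[ℝ] L` as `1 ⊗ X`) fixed
by a `ℂ`-linear endomorphism `f` of `ℂ ⊗[ℝ] L`; for `f = f_ε̂` this is `g_ε̂`. -/
def realFixedPoints {L : Type*} [LieRing L] [LieAlgebra ℝ L]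
    (f : (ℂ ⊗[ℝ] L) →ₗ[ℂ] (ℂ ⊗[ℝ] L)) : Submodule ℝ L :=
  LinearMap.ker ((f.restrictScalars ℝ ∘ₗ TensorProduct.mk ℝ ℂ L 1) -
    TensorProduct.mk ℝ ℂ L 1)

open scoped Function in
/-- Commuting operators that are symmetric for a positive definite form are simultaneously
diagonalizable. -/
theorem aux_joint_diag {V ι : Type*} [AddCommGroup V] [Module ℝ V] [FiniteDimensional ℝ V]
    (B : V →ₗ[ℝ] V →ₗ[ℝ] ℝ) (hs : ∀ x y, B x y = B y x) (hp : ∀ x, x ≠ 0 → 0 < B x x)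
    (T : ι → V →ₗ[ℝ] V) (hT : ∀ i x y, B (T i x) y = B x (T i y))
    (hc : ∀ i j, Commute (T i) (T j)) :
    ⨆ χ : ι → ℝ, ⨅ i, Module.End.eigenspace (T i) (χ i) = ⊤ := by
  let cd : InnerProductSpace.Core ℝ V :=
    { inner := fun x y => B x y
      conj_inner_symm := fun x y => by simp [hs x y]
      re_inner_nonneg := fun x => by
        by_cases hx : x = 0
        · simp [hx]
        · simpa using (hp x hx).le
      add_left := fun x y z => by simp
      smul_left := fun x y r => by simp
      definite := fun x hx => by
        by_contra h
        exact (hp x h).ne' hx }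
  letI : NormedAddCommGroup V := cd.toNormedAddCommGroup
  letI : InnerProductSpace ℝ V := InnerProductSpace.ofCore cd.toCore
  exact LinearMap.IsSymmetric.iSup_iInf_eq_top_of_commute (T := T)
    (fun i x y => hT i x y) (fun i j _ => hc i j)

theorem aux_mem_rootSpace {a : Submodule ℝ L} {α : Module.Dual ℝ a} {X : L} :
    X ∈ rootSpace' a α ↔ ∀ Y : a, ⁅(Y : L), X⁆ = α Y • X := by
  simp [rootSpace', Submodule.mem_iInf, sub_eq_zero]

/-- The root spaces span `L`. -/
theorem aux_span [FiniteDimensional ℝ L]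
    (θ : L →ₗ[ℝ] L) (hθ : IsCartanInvolution θ) (a : Submodule ℝ L)
    (haθ : a ≤ negFixedSet θ) (hab : ∀ X ∈ a, ∀ Y ∈ a, ⁅X, Y⁆ = (0 : L)) :
    ⨆ α : Module.Dual ℝ a, rootSpace' a α = ⊤ := by
  have key := aux_joint_diag (V := L) (ι := a) (-((killingForm ℝ L).compl₂ θ))
    (fun x y => by simpa using hθ.2.1 x y) (fun x hx => by simpa using hθ.2.2 x hx)
    (fun Y => LieAlgebra.ad ℝ L (Y : L))
    (fun Y x y => by
      have hY : θ (Y : L) = -(Y : L) := by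
        have := haθ Y.2
        simpa [negFixedSet, add_eq_zero_iff_eq_neg] using this
      have h1 : θ ⁅(Y : L), y⁆ = -⁅(Y : L), θ y⁆ := by
        rw [hθ.1.1, hY, neg_lie]
      have h2 := LieModule.traceForm_apply_lie_apply' ℝ L L (Y : L) x (θ y)
      simp only [LinearMap.neg_apply, LinearMap.compl₂_apply, LieAlgebra.ad_apply, h1, map_neg]
      exact congrArg Neg.neg h2)
    (fun Y Z => by
      ext X
      simp only [Module.End.mul_apply, LieAlgebra.ad_apply]
      rw [leibniz_lie (Y : L) (Z : L) X, hab _ Y.2 _ Z.2, zero_lie, zero_add])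
  rw [eq_top_iff, ← key]
  refine iSup_le fun χ X hX => ?_
  by_cases hX0 : X = 0
  · rw [hX0]; exact zero_mem _
  have hX' : ∀ Y : a, ⁅(Y : L), X⁆ = χ Y • X := by
    intro Y
    have := (Submodule.mem_iInf _).1 hX Y
    simpa [Module.End.mem_eigenspace_iff] using this
  let α : Module.Dual ℝ a :=
    { toFun := χ
      map_add' := fun Y Z => by
        apply smul_left_injective ℝ hX0
        simp only
        rw [add_smul, ← hX', ← hX', ← hX', Submodule.coe_add, add_lie]
      map_smul' := fun r Y => by
        apply smul_left_injective ℝ hX0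
        simp only [RingHom.id_apply, smul_eq_mul]
        rw [mul_smul, ← hX', ← hX', Submodule.coe_smul, smul_lie] }
  exact Submodule.mem_iSup_of_mem α (aux_mem_rootSpace.2 hX')

theorem aux_mem_fixed {g : L →ₗ[ℝ] L} {X : L} : X ∈ fixedSet g ↔ g X = X := by
  simp [fixedSet, sub_eq_zero]

theorem aux_fixed_baseChange (g : L →ₗ[ℝ] L) (x : ℂ ⊗[ℝ] L) :
    x ∈ (fixedSet g).baseChange ℂ ↔ g.baseChange ℂ x = x := by
  have h := Module.Flat.ker_lTensor_eq (R := ℝ) ℂ ℂ (g - LinearMap.id)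
  have h' : (fixedSet g).baseChange ℂ =
      LinearMap.ker ((g - LinearMap.id).baseChange ℂ) := h.symm
  rw [h', LinearMap.mem_ker, LinearMap.baseChange_sub, LinearMap.sub_apply, sub_eq_zero,
    LinearMap.baseChange_id, LinearMap.id_apply]

theorem aux_mk_inj {X Y : L} (h : (1 : ℂ) ⊗ₜ[ℝ] X = 1 ⊗ₜ[ℝ] Y) : X = Y :=
  Module.FaithfullyFlat.tensorProduct_mk_injective (A := ℝ) (B := ℂ) L h

/-- `f ∘ σ = σ_ε ∘ f` on the complexification. -/
theorem aux_intertwine (σ : L →ₗ[ℝ] L) (hσ : IsInvolutiveLieAut σ)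
    (a : Submodule ℝ L) (haσ : a ≤ negFixedSet σ)
    (hspan : ⨆ α : Module.Dual ℝ a, rootSpace' a α = ⊤)
    (ε : Module.Dual ℝ a → ℝ)
    (εh : Module.Dual ℝ a → ℂ) (hεh : IsHalfSignatureOn (restrictedRoots a) εh)
    (hsq : ∀ α ∈ restrictedRoots a, εh α ^ 2 = (ε α : ℂ))
    (σε : L →ₗ[ℝ] L) (hσε : IsSigmaEps σ a ε σε)
    (f : (ℂ ⊗[ℝ] L) →ₗ[ℂ] (ℂ ⊗[ℝ] L))
    (hfz : ∀ x ∈ (rootSpace' a 0).baseChange ℂ, f x = x)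
    (hfroot : ∀ α ∈ restrictedRoots a, ∀ x ∈ (rootSpace' a α).baseChange ℂ,
      f x = εh α • x) (x : ℂ ⊗[ℝ] L) :
    f (σ.baseChange ℂ x) = σε.baseChange ℂ (f x) := by
  have hmap : ∀ α : Module.Dual ℝ a, ∀ X ∈ rootSpace' a α, σ X ∈ rootSpace' a (-α) := by
    intro α X hX
    rw [aux_mem_rootSpace] at hX ⊢
    intro Y
    have hY : σ (Y : L) = -(Y : L) := by
      have := haσ Y.2
      simpa [negFixedSet, add_eq_zero_iff_eq_neg] using this
    have h := congrArg σ (hX Y)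
    rw [hσ.1, hY, neg_lie, map_smul] at h
    rw [LinearMap.neg_apply, neg_smul, ← h, neg_neg]
  have hreal : ∀ X : L, f (1 ⊗ₜ[ℝ] σ X) = σε.baseChange ℂ (f (1 ⊗ₜ[ℝ] X)) := by
    intro X
    have hX : X ∈ ⨆ α : Module.Dual ℝ a, rootSpace' a α := hspan ▸ Submodule.mem_top
    induction hX using Submodule.iSup_induction' with
    | mem α X hX =>
      by_cases hX0 : X = 0
      · simp [hX0]
      by_cases hα : α = 0
      · subst hα
        have h1 := hmap 0 X hX
        rw [neg_zero] at h1
        rw [hfz _ (Submodule.tmul_mem_baseChange_of_mem 1 h1),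
          hfz _ (Submodule.tmul_mem_baseChange_of_mem 1 hX), LinearMap.baseChange_tmul,
          hσε.1 X hX]
      have hr : α ∈ restrictedRoots a :=
        ⟨hα, fun h => hX0 (by rw [h] at hX; simpa using hX)⟩
      have hσX := hmap α X hX
      have hr' : -α ∈ restrictedRoots a := by
        refine ⟨neg_ne_zero.2 hα, fun h => hX0 ?_⟩
        rw [h, Submodule.mem_bot] at hσX
        rw [← hσ.2 X, hσX, map_zero]
      rw [hfroot _ hr' _ (Submodule.tmul_mem_baseChange_of_mem 1 hσX),
        hfroot _ hr _ (Submodule.tmul_mem_baseChange_of_mem 1 hX), map_smul,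
        LinearMap.baseChange_tmul, hσε.2 α hr X hX, hεh.2.1 α hr hr']
      rw [TensorProduct.tmul_smul, ← algebraMap_smul ℂ (ε α), smul_smul]
      congr 1
      have h2 := hsq α hr
      change _ = εh α * (ε α : ℂ)
      rw [← h2]
      rcases hεh.1 α hr with h | h | h | h <;> rw [h] <;> simp
    | zero => simp
    | add X Y _ _ hX hY => simp only [map_add, TensorProduct.tmul_add, hX, hY]
  induction x with
  | zero => simp
  | add x y hx hy => simp only [map_add, hx, hy]
  | tmul z X =>
    have h1 : z ⊗ₜ[ℝ] X = z • ((1 : ℂ) ⊗ₜ[ℝ] X) := by simp [TensorProduct.smul_tmul']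
    rw [h1, map_smul, map_smul, map_smul, map_smul, LinearMap.baseChange_tmul, hreal]

/-- Let `(g,h)` be a semisimple symmetric pair with commuting
involutions `σ, θ`, `a` a maximal abelian subspace of `p ∩ q` and `Σ` the restricted root
system.  Let `ε` be a signature of `Σ` and `ε̂` a half-signature with `ε̂² = ε`, and let
`f = f_ε̂` be the `ℂ`-linear Lie algebra automorphism of `g_ℂ = ℂ ⊗_ℝ g` which is the
identity on `(z_g(a))_ℂ` and multiplication by `ε̂(α)` on each `(g_α)_ℂ`.  Then
(1) `f` maps `h_ℂ` onto `(h_ε)_ℂ`; and (2) `h ∩ g_ε̂ = h_ε ∩ g_ε̂`. -/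
theorem statement10 {L : Type*} [LieRing L] [LieAlgebra ℝ L] [FiniteDimensional ℝ L]
    [LieAlgebra.IsSemisimple ℝ L]
    (σ θ : L →ₗ[ℝ] L) (hσ : IsInvolutiveLieAut σ) (hθ : IsCartanInvolution θ)
    (hcomm : ∀ X : L, θ (σ X) = σ (θ X))
    (a : Submodule ℝ L)
    (ha : IsMaxAbelianSubspaceOf (negFixedSet θ ⊓ negFixedSet σ) a)
    (ε : Module.Dual ℝ a → ℝ) (hε : IsSignatureOn (restrictedRoots a) ε)
    (εh : Module.Dual ℝ a → ℂ) (hεh : IsHalfSignatureOn (restrictedRoots a) εh)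
    (hsq : ∀ α ∈ restrictedRoots a, εh α ^ 2 = (ε α : ℂ))
    (σε : L →ₗ[ℝ] L) (hσε : IsSigmaEps σ a ε σε)
    (f : (ℂ ⊗[ℝ] L) →ₗ[ℂ] (ℂ ⊗[ℝ] L))
    (hfLie : ∀ x y : ℂ ⊗[ℝ] L, f ⁅x, y⁆ = ⁅f x, f y⁆) (hfBij : Function.Bijective f)
    (hfz : ∀ x ∈ (rootSpace' a 0).baseChange ℂ, f x = x)
    (hfroot : ∀ α ∈ restrictedRoots a, ∀ x ∈ (rootSpace' a α).baseChange ℂ,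
      f x = εh α • x) :
    Submodule.map f ((fixedSet σ).baseChange ℂ) = (fixedSet σε).baseChange ℂ ∧
      fixedSet σ ⊓ realFixedPoints f = fixedSet σε ⊓ realFixedPoints f := by
  have hspan := aux_span θ hθ a (ha.1.trans inf_le_left) ha.2.1
  have hint := aux_intertwine σ hσ a (ha.1.trans inf_le_right) hspan ε εh hεh hsq σε hσε f hfz
    hfroot
  refine ⟨?_, ?_⟩
  · ext y
    rw [Submodule.mem_map, aux_fixed_baseChange]
    constructor
    · rintro ⟨x, hx, rfl⟩
      rw [aux_fixed_baseChange] at hx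
      rw [← hint, hx]
    · intro hy
      obtain ⟨x, rfl⟩ := hfBij.2 y
      refine ⟨x, ?_, rfl⟩
      rw [aux_fixed_baseChange]
      apply hfBij.1
      rw [hint, hy]
  · ext X
    rw [Submodule.mem_inf, Submodule.mem_inf, aux_mem_fixed, aux_mem_fixed]
    refine and_congr_left fun hX => ?_
    have hfX : f (1 ⊗ₜ[ℝ] X) = 1 ⊗ₜ[ℝ] X := by
      simpa [realFixedPoints, sub_eq_zero] using hX
    have h := hint (1 ⊗ₜ[ℝ] X)
    rw [hfX, LinearMap.baseChange_tmul, LinearMap.baseChange_tmul] at h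
    constructor
    · intro hs
      rw [hs, hfX] at h
      exact (aux_mk_inj h).symm
    · intro hs
      rw [hs, ← hfX] at h
      exact aux_mk_inj (hfBij.1 h)

end
end

section
/- Let Σ be a (possibly non-reduced) root system in a finite-dimensional real vector space and Ψ a simple system (base) of Σ. Then the restriction map ε ↦ ε|_Ψ is a bijection from the set of signatures of Σ onto the set of all maps Ψ → {±1}; in other words, every map Ψ → {±1} extends uniquely to a signature of Σ. -/
/-!
Statement 15: every map from a simple system `Ψ` of a (possibly non-reduced) root system
`Σ` to `{±1}` extends uniquely to a signature of `Σ`; i.e. the restriction map is a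
bijection from the set of signatures of `Σ` onto the set of maps `Ψ → {±1}`.
-/

open RealInnerProductSpace in
/-- A (possibly non-reduced) root system in a finite-dimensional real inner product space
`V`: a finite set of nonzero vectors spanning `V`, stable under the reflections `s_α` it
determines, and satisfying the integrality condition `2⟪β,α⟫/⟪α,α⟫ ∈ ℤ`. -/
def IsRootSystem {V : Type*} [NormedAddCommGroup V] [InnerProductSpace ℝ V]
    [FiniteDimensional ℝ V] (S : Set V) : Prop :=
  S.Finite ∧ (0 : V) ∉ S ∧ Submodule.span ℝ S = ⊤ ∧
    (∀ α ∈ S, ∀ β ∈ S, β - (2 * ⟪β, α⟫ / ⟪α, α⟫) • α ∈ S) ∧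
    (∀ α ∈ S, ∀ β ∈ S, ∃ n : ℤ, 2 * ⟪β, α⟫ / ⟪α, α⟫ = (n : ℝ))

/-- `Ψ` is a simple system (base) of the root system `S`: a linearly independent subset
such that every root is an integer linear combination of elements of `Ψ` with coefficients
all nonnegative or all nonpositive. -/
def IsSimpleSystem {V : Type*} [AddCommGroup V] [Module ℝ V] (S Ψ : Set V) : Prop :=
  Ψ ⊆ S ∧ LinearIndependent ℝ (fun ψ : Ψ => (ψ : V)) ∧
    ∀ α ∈ S, ∃ c : V →₀ ℤ, ↑c.support ⊆ Ψ ∧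
      α = c.sum (fun v n => (n : ℝ) • v) ∧ ((∀ v, 0 ≤ c v) ∨ (∀ v, c v ≤ 0))

/-- A signature of the root system `S`: a map `ε : S → {±1}` with `ε(−α) = ε(α)` and
`ε(α+β) = ε(α)ε(β)` whenever `α, β, α+β ∈ S`. -/
def IsSignature {V : Type*} [AddCommGroup V] [Module ℝ V] (S : Set V)
    (ε : S → ℝ) : Prop :=
  (∀ a, ε a = 1 ∨ ε a = -1) ∧
    (∀ a b : S, (b : V) = -(a : V) → ε b = ε a) ∧
    (∀ a b c : S, (c : V) = (a : V) + (b : V) → ε c = ε a * ε b)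

open RealInnerProductSpace in
theorem rs_neg_mem {V : Type*} [NormedAddCommGroup V] [InnerProductSpace ℝ V]
    [FiniteDimensional ℝ V] {S : Set V} (hS : IsRootSystem S) {α : V} (hα : α ∈ S) :
    -α ∈ S := by
  obtain ⟨-, h0, -, hr, -⟩ := hS
  have h := hr α hα α hα
  have hne : α ≠ 0 := fun h => h0 (h ▸ hα)
  have hp : ⟪α, α⟫ ≠ 0 := inner_self_ne_zero.mpr hne
  have h2 : 2 * ⟪α, α⟫ / ⟪α, α⟫ = (2 : ℝ) := by field_simp
  rw [h2] at h
  have h3 : α - (2 : ℝ) • α = -α := by module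
  rwa [h3] at h

open RealInnerProductSpace in
theorem rs_sub_mem {V : Type*} [NormedAddCommGroup V] [InnerProductSpace ℝ V]
    [FiniteDimensional ℝ V] {S : Set V} (hS : IsRootSystem S) {α β : V} (hα : α ∈ S)
    (hβ : β ∈ S) (hpos : 0 < ⟪α, β⟫) (hne : α ≠ β) : α - β ∈ S := by
  have hneg : ∀ {γ : V}, γ ∈ S → -γ ∈ S := fun h => rs_neg_mem hS h
  obtain ⟨-, h0, -, hr, hi⟩ := hS
  have hα0 : α ≠ 0 := fun h => h0 (h ▸ hα)
  have hβ0 : β ≠ 0 := fun h => h0 (h ▸ hβ)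
  have pα : 0 < ⟪α, α⟫ := real_inner_self_pos.mpr hα0
  have pβ : 0 < ⟪β, β⟫ := real_inner_self_pos.mpr hβ0
  have hc : ⟪β, α⟫ = ⟪α, β⟫ := real_inner_comm _ _
  obtain ⟨n, hn⟩ := hi α hα β hβ
  obtain ⟨m, hm⟩ := hi β hβ α hα
  have hn0 : (0 : ℝ) < n := by rw [← hn, hc]; positivity
  have hm0 : (0 : ℝ) < m := by rw [← hm]; positivity
  have hn1 : 0 < n := by exact_mod_cast hn0
  have hm1 : 0 < m := by exact_mod_cast hm0
  have r1 := hr α hα β hβ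
  have r2 := hr β hβ α hα
  rw [hn] at r1
  rw [hm] at r2
  by_cases en : n = 1
  · subst en
    have := hneg r1
    simpa using this
  by_cases em : m = 1
  · subst em
    simpa using r2
  exfalso
  have n2 : (2 : ℝ) ≤ n := by exact_mod_cast (by omega : 2 ≤ n)
  have m2 : (2 : ℝ) ≤ m := by exact_mod_cast (by omega : 2 ≤ m)
  rw [← hn, le_div_iff₀ pα] at n2
  rw [← hm, le_div_iff₀ pβ] at m2
  have hq : 0 < ⟪α - β, α - β⟫ := real_inner_self_pos.mpr (sub_ne_zero.mpr hne)
  rw [real_inner_sub_sub_self] at hq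
  linarith

open RealInnerProductSpace in
theorem rs_unique_pos {V : Type*} [NormedAddCommGroup V] [InnerProductSpace ℝ V]
    [FiniteDimensional ℝ V] {S Ψ : Set V} (hS : IsRootSystem S) (hsub : Ψ ⊆ S)
    {ε δ : S → ℝ} (hε : IsSignature S ε) (hδ : IsSignature S δ)
    (heq : ∀ (v : V) (hv : v ∈ Ψ), ε ⟨v, hsub hv⟩ = δ ⟨v, hsub hv⟩) (N : ℕ) :
    ∀ (α : V) (hα : α ∈ S) (c : V →₀ ℤ), (c.support : Set V) ⊆ Ψ →
      α = c.sum (fun v n => (n : ℝ) • v) → (∀ v, 0 ≤ c v) →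
      c.sum (fun _ n => n) = (N : ℤ) → ε ⟨α, hα⟩ = δ ⟨α, hα⟩ := by
  induction N with
  | zero =>
    intro α hα c hc hs hp hN
    exfalso
    have hz : ∀ v ∈ c.support, c v = 0 :=
      (Finset.sum_eq_zero_iff_of_nonneg (fun v _ => hp v)).mp (by simpa [Finsupp.sum] using hN)
    apply hS.2.1
    have : α = 0 := by
      rw [hs, Finsupp.sum]
      exact Finset.sum_eq_zero fun v hv => by simp [hz v hv]
    rwa [this] at hα
  | succ N ih =>
    intro α hα c hc hs hp hN
    have hα0 : α ≠ 0 := fun h => hS.2.1 (h ▸ hα)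
    have pα : 0 < ⟪α, α⟫ := real_inner_self_pos.mpr hα0
    have hsum : ⟪α, α⟫ = ∑ v ∈ c.support, (c v : ℝ) * ⟪α, v⟫ := by
      have h : ⟪α, c.sum (fun v n => (n : ℝ) • v)⟫ = ∑ v ∈ c.support, (c v : ℝ) * ⟪α, v⟫ := by
        rw [Finsupp.sum, inner_sum]
        exact Finset.sum_congr rfl fun v _ => by rw [real_inner_smul_right]
      rwa [← hs] at h
    rw [hsum] at pα
    obtain ⟨v, hv, hvp⟩ := Finset.exists_lt_of_sum_lt (s := c.support) (f := fun _ => (0 : ℝ))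
      (g := fun v => (c v : ℝ) * ⟪α, v⟫) (by simpa using pα)
    have hcv : 0 < c v := lt_of_le_of_ne (hp v) (Ne.symm (Finsupp.mem_support_iff.mp hv))
    have hcv' : (0 : ℝ) < c v := by exact_mod_cast hcv
    have hin : 0 < ⟪α, v⟫ := pos_of_mul_pos_right hvp hcv'.le
    have hvΨ : v ∈ Ψ := hc hv
    by_cases hav : α = v
    · subst hav
      exact heq α hvΨ
    have hm := rs_sub_mem hS hα (hsub hvΨ) hin hav
    have key := ih (α - v) hm (c - Finsupp.single v 1) ?_ ?_ ?_ ?_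
    · rw [hε.2.2 ⟨α - v, hm⟩ ⟨v, hsub hvΨ⟩ ⟨α, hα⟩ (by simp),
        hδ.2.2 ⟨α - v, hm⟩ ⟨v, hsub hvΨ⟩ ⟨α, hα⟩ (by simp), key, heq v hvΨ]
    · intro w hw
      by_cases hwv : w = v
      · rw [hwv]; exact hvΨ
      · apply hc
        simp [hwv] at hw ⊢
        exact hw
    · rw [Finsupp.sum_sub_index (by intros; push_cast; module), ← hs]
      simp
    · intro w
      by_cases hwv : v = w
      · subst hwv; simp; omega
      · simpa [Finsupp.single_apply, hwv] using hp w
    · rw [Finsupp.sum_sub_index (by intros; rfl), hN]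
      simp

theorem rs_coeff_unique {V : Type*} [AddCommGroup V] [Module ℝ V] {Ψ : Set V}
    (hli : LinearIndependent ℝ (fun ψ : Ψ => (ψ : V))) {c d : V →₀ ℤ}
    (hc : (c.support : Set V) ⊆ Ψ) (hd : (d.support : Set V) ⊆ Ψ)
    (h : c.sum (fun v n => (n : ℝ) • v) = d.sum (fun v n => (n : ℝ) • v)) : c = d := by
  have h1 : LinearIndepOn ℤ (id : V → V) Ψ := hli.restrict_scalars' ℤ
  have h2 := linearIndepOn_iff.mp h1 (c - d)
    (Submodule.sub_mem _ ((Finsupp.mem_supported _ _).mpr hc) ((Finsupp.mem_supported _ _).mpr hd))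
  apply sub_eq_zero.mp
  apply h2
  rw [map_sub, sub_eq_zero, Finsupp.linearCombination_apply, Finsupp.linearCombination_apply]
  simpa [Int.cast_smul_eq_zsmul] using h

theorem rs_sq_zpow {x : ℝ} (hx : x = 1 ∨ x = -1) (n : ℤ) : x ^ n = 1 ∨ x ^ n = -1 := by
  rcases hx with rfl | rfl
  · simp
  · rcases Int.even_or_odd n with h | h
    · exact Or.inl h.neg_one_zpow
    · exact Or.inr h.neg_one_zpow

/-- For a (possibly non-reduced) root system `S` in a finite-dimensional
real vector space and a simple system `Ψ` of `S`, the restriction map `ε ↦ ε|_Ψ` is a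
bijection from the set of signatures of `S` onto the set of all maps `Ψ → {±1}`. -/
theorem statement15 {V : Type*} [NormedAddCommGroup V] [InnerProductSpace ℝ V]
    [FiniteDimensional ℝ V] (S Ψ : Set V) (hS : IsRootSystem S)
    (hΨ : IsSimpleSystem S Ψ) :
    Function.Bijective
      (fun ε : {ε : S → ℝ // IsSignature S ε} =>
        (⟨fun ψ : Ψ => ε.val ⟨(ψ : V), hΨ.1 ψ.2⟩, fun ψ => ε.prop.1 _⟩ :
          {f : Ψ → ℝ // ∀ ψ, f ψ = 1 ∨ f ψ = -1})) := by
  classical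
  obtain ⟨hsub, hli, hco⟩ := hΨ
  constructor
  · rintro ⟨ε, hε⟩ ⟨δ, hδ⟩ h
    have heq : ∀ (v : V) (hv : v ∈ Ψ), ε ⟨v, hsub hv⟩ = δ ⟨v, hsub hv⟩ := fun v hv =>
      congrFun (congrArg Subtype.val h) ⟨v, hv⟩
    apply Subtype.ext
    funext ⟨α, hα⟩
    change ε ⟨α, hα⟩ = δ ⟨α, hα⟩
    have pos : ∀ (α : V) (hα : α ∈ S) (c : V →₀ ℤ), (c.support : Set V) ⊆ Ψ →
      α = c.sum (fun v n => (n : ℝ) • v) → (∀ v, 0 ≤ c v) → ε ⟨α, hα⟩ = δ ⟨α, hα⟩ := by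
      intro α hα c h1 h2 h3
      exact rs_unique_pos hS hsub hε hδ heq (c.sum fun _ n => n).toNat α hα c h1 h2 h3
        (Int.toNat_of_nonneg (Finset.sum_nonneg fun v _ => h3 v)).symm
    obtain ⟨c, h1, h2, h3 | h3⟩ := hco α hα
    · exact pos α hα c h1 h2 h3
    · have hn := rs_neg_mem hS hα
      have := pos (-α) hn (-c) (by simpa using h1) (by
        rw [Finsupp.sum_neg_index (by simp), h2]
        simp [Finsupp.sum]) (by intro v; simpa using h3 v)
      rw [← hε.2.1 ⟨α, hα⟩ ⟨-α, hn⟩ rfl, ← hδ.2.1 ⟨α, hα⟩ ⟨-α, hn⟩ rfl, this]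
  · rintro ⟨f, hf⟩
    let g : V → ℝ := fun v => if h : v ∈ Ψ then f ⟨v, h⟩ else 1
    have hg : ∀ v, g v = 1 ∨ g v = -1 := by
      intro v
      by_cases h : v ∈ Ψ
      · simpa [g, h] using hf ⟨v, h⟩
      · simp [g, h]
    have hg0 : ∀ v, g v ≠ 0 := fun v => by rcases hg v with h | h <;> rw [h] <;> norm_num
    let P : (V →₀ ℤ) → ℝ := fun c => c.prod fun v n => g v ^ n
    have hP : ∀ c, P c = 1 ∨ P c = -1 := by
      intro c
      refine Finset.prod_induction (fun v => g v ^ (c v)) (fun x : ℝ => x = 1 ∨ x = -1) ?_ ?_ ?_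
      · rintro a b (rfl | rfl) (rfl | rfl) <;> simp
      · simp
      · intro v _; exact rs_sq_zpow (hg v) _
    have hPadd : ∀ c d, P (c + d) = P c * P d := fun c d =>
      Finsupp.prod_add_index' (by simp) (fun v m n => zpow_add₀ (hg0 v) m n)
    have hco2 := hco
    choose c hc1 hc2 hc3 using hco2
    have hadd : ∀ (α β γ : V) (hα : α ∈ S) (hβ : β ∈ S) (hγ : γ ∈ S), γ = α + β →
        c γ hγ = c α hα + c β hβ := by
      intro α β γ hα hβ hγ h
      apply rs_coeff_unique hli (hc1 _ _)
      · intro v hv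
        rcases Finset.mem_union.mp (Finsupp.support_add hv) with h | h
        · exact hc1 _ _ h
        · exact hc1 _ _ h
      · rw [Finsupp.sum_add_index' (by simp) (by intros; push_cast; module), ← hc2, ← hc2, ← hc2, h]
    have hneg : ∀ (α β : V) (hα : α ∈ S) (hβ : β ∈ S), β = -α → c β hβ = - c α hα := by
      intro α β hα hβ h
      apply rs_coeff_unique hli (hc1 _ _) (by simpa using hc1 _ _)
      rw [Finsupp.sum_neg_index (by simp), ← hc2, h]
      conv_lhs => rw [hc2 α hα]
      simp [Finsupp.sum]
    refine ⟨⟨fun a => P (c a.1 a.2), fun a => hP _, ?_, ?_⟩, ?_⟩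
    · intro a b h
      change P (c b.1 b.2) = P (c a.1 a.2)
      have h1 := hPadd (c b.1 b.2) (c a.1 a.2)
      rw [hneg a.1 b.1 a.2 b.2 h, neg_add_cancel] at h1
      have h0 : P 0 = 1 := Finsupp.prod_zero_index
      rw [h0] at h1
      rw [hneg a.1 b.1 a.2 b.2 h]
      rcases hP (-c a.1 a.2) with h2 | h2 <;> rcases hP (c a.1 a.2) with h3 | h3 <;>
        rw [h2, h3] at h1 ⊢ <;> norm_num at h1
    · intro a b d h
      change P (c d.1 d.2) = P (c a.1 a.2) * P (c b.1 b.2)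
      rw [hadd _ _ _ a.2 b.2 d.2 h, hPadd]
    · apply Subtype.ext
      funext ⟨v, hv⟩
      change P (c v (hsub hv)) = f ⟨v, hv⟩
      have : c v (hsub hv) = Finsupp.single v 1 := by
        apply rs_coeff_unique hli (hc1 _ _)
        · intro w hw
          have := Finsupp.support_single_subset hw
          rw [Finset.mem_singleton.mp this]
          exact hv
        · rw [← hc2]; simp
      rw [this]
      simp [P, g, hv]
end

section
/- Let Σ be a (possibly non-reduced) root system in a finite-dimensional real vector space and Ψ a simple system (base) of Σ with r elements. Then: (1) the restriction map ε̂ ↦ ε̂|_Ψ is a bijection from the set of half-signatures of Σ onto the set of all maps Ψ → {±1, ±√−1}; and (2) for every signature ε of Σ, there exist exactly 2^r half-signatures ε̂ of Σ with ε̂² = ε. -/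
/-- A half-signature of the root system `S`: a map `ε̂ : S → {±1, ±√−1}` (fourth roots of
unity in `ℂ`) with `ε̂(−α) = ε̂(α)⁻¹` and `ε̂(α+β) = ε̂(α)ε̂(β)` whenever `α, β, α+β ∈ S`. -/
def IsHalfSignature {V : Type*} [AddCommGroup V] [Module ℝ V] (S : Set V)
    (ε : S → ℂ) : Prop :=
  (∀ a, ε a = 1 ∨ ε a = -1 ∨ ε a = Complex.I ∨ ε a = -Complex.I) ∧
    (∀ a b : S, (b : V) = -(a : V) → ε b = (ε a)⁻¹) ∧
    (∀ a b c : S, (c : V) = (a : V) + (b : V) → ε c = ε a * ε b)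

open RealInnerProductSpace in
lemma rs_neg {V : Type*} [NormedAddCommGroup V] [InnerProductSpace ℝ V]
    [FiniteDimensional ℝ V] {S : Set V} (hS : IsRootSystem S) {α : V} (h : α ∈ S) : -α ∈ S := by
  have h0 : α ≠ 0 := fun h1 => hS.2.1 (h1 ▸ h)
  have h1 : ⟪α, α⟫ ≠ 0 := by simpa using h0
  have h2 := hS.2.2.2.1 α h α h
  rw [mul_div_assoc, div_self h1] at h2
  convert h2 using 1
  module

open RealInnerProductSpace in
lemma rs_sub {V : Type*} [NormedAddCommGroup V] [InnerProductSpace ℝ V]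
    [FiniteDimensional ℝ V] {S : Set V} (hS : IsRootSystem S) {α β : V} (ha : α ∈ S)
    (hb : β ∈ S) (hne : α ≠ β) (hpos : 0 < ⟪α, β⟫) : α - β ∈ S := by
  have ha0 : α ≠ 0 := fun h1 => hS.2.1 (h1 ▸ ha)
  have hb0 : β ≠ 0 := fun h1 => hS.2.1 (h1 ▸ hb)
  have ha1 : 0 < ⟪α, α⟫ := real_inner_self_pos.mpr ha0
  have hb1 : 0 < ⟪β, β⟫ := real_inner_self_pos.mpr hb0
  have hsymm : ⟪β, α⟫ = ⟪α, β⟫ := real_inner_comm _ _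
  obtain ⟨n, hn⟩ := hS.2.2.2.2 β hb α ha
  obtain ⟨m, hm⟩ := hS.2.2.2.2 α ha β hb
  have r1 := hS.2.2.2.1 β hb α ha
  have r2 := hS.2.2.2.1 α ha β hb
  rw [hn] at r1
  rw [hm] at r2
  rw [hsymm] at hm
  have hn0 : (0 : ℝ) < n := by rw [← hn]; positivity
  have hm0 : (0 : ℝ) < m := by rw [← hm]; positivity
  have hn0' : 0 < n := by exact_mod_cast hn0
  have hm0' : 0 < m := by exact_mod_cast hm0
  by_cases hn1 : n = 1
  · subst hn1
    simpa using r1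
  by_cases hm1 : m = 1
  · subst hm1
    have := rs_neg hS r2
    simpa using this
  exfalso
  have hn2 : (2 : ℝ) ≤ n := by exact_mod_cast (by omega : (2 : ℤ) ≤ n)
  have hm2 : (2 : ℝ) ≤ m := by exact_mod_cast (by omega : (2 : ℤ) ≤ m)
  rw [← hn, le_div_iff₀ hb1] at hn2
  rw [← hm, le_div_iff₀ ha1] at hm2
  have : 0 < ⟪α - β, α - β⟫ := real_inner_self_pos.mpr (sub_ne_zero.mpr hne)
  rw [real_inner_sub_sub_self] at this
  linarith

open RealInnerProductSpace in
/-- A positive combination which is a root is simple or can be lowered by a simple root. -/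
lemma rs_pos_induct {V : Type*} [NormedAddCommGroup V] [InnerProductSpace ℝ V]
    [FiniteDimensional ℝ V] {S Ψ : Set V} (hS : IsRootSystem S) (hΨ : IsSimpleSystem S Ψ)
    (P : V → Prop) (h1 : ∀ ψ ∈ Ψ, P ψ)
    (h2 : ∀ α ∈ S, ∀ ψ ∈ Ψ, α + ψ ∈ S → P α → P (α + ψ)) (k : ℕ) :
    ∀ (c : V →₀ ℤ), ↑c.support ⊆ Ψ → (∀ v, 0 ≤ c v) → (c.sum (fun _ n => n) = k) →
      c.sum (fun v n => (n : ℝ) • v) ∈ S → P (c.sum (fun v n => (n : ℝ) • v)) := by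
  induction k with
  | zero =>
    intro c hc hpos hk hmem
    exfalso
    have hz : c = 0 := by
      ext v
      by_contra hv
      have hv' : v ∈ c.support := by simpa using hv
      have := (Finset.sum_eq_zero_iff_of_nonneg (fun v _ => hpos v)).mp
        (by simpa [Finsupp.sum] using hk) v hv'
      exact hv this
    subst hz
    exact hS.2.1 (by simpa using hmem)
  | succ k ih =>
    intro c hc hpos hk hmem
    set α := c.sum (fun v n => (n : ℝ) • v) with hα
    by_cases hαΨ : α ∈ Ψ
    · exact h1 _ hαΨ
    have ha0 : α ≠ 0 := fun h => hS.2.1 (h ▸ hmem)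
    have ha1 : 0 < ⟪α, α⟫ := real_inner_self_pos.mpr ha0
    have ha2 : ⟪α, α⟫ = ∑ v ∈ c.support, (c v : ℝ) * ⟪α, v⟫ := by
      have : ⟪α, α⟫ = ⟪α, ∑ v ∈ c.support, (c v : ℝ) • v⟫ := rfl
      rw [this, inner_sum]
      simp only [inner_smul_right]
    rw [ha2] at ha1
    obtain ⟨ψ, hψc, hψ⟩ := Finset.exists_lt_of_sum_lt (s := c.support) (f := fun _ => (0 : ℝ))
      (by simpa using ha1)
    have hcψ : 0 < c ψ := lt_of_le_of_ne (hpos ψ) (by simpa [eq_comm] using hψc)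
    have hcψ' : (0 : ℝ) < c ψ := by exact_mod_cast hcψ
    have hin : 0 < ⟪α, ψ⟫ := (pos_iff_pos_of_mul_pos hψ).mp hcψ'
    have hψΨ : ψ ∈ Ψ := hc hψc
    have hsub := rs_sub hS hmem (hΨ.1 hψΨ) (fun h => hαΨ (h ▸ hψΨ)) hin
    have hc' : c = (c - Finsupp.single ψ 1) + Finsupp.single ψ 1 := by simp
    set d := c - Finsupp.single ψ 1 with hd
    have hdsum : d.sum (fun v n => (n : ℝ) • v) = α - ψ := by
      rw [hα, hc', Finsupp.sum_add_index' (by simp) (by intros; push_cast; module)]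
      simp
    have hdk : d.sum (fun _ n => n) = k := by
      rw [hc', Finsupp.sum_add_index' (by simp) (by simp)] at hk
      simp at hk
      linarith
    have := ih d ?_ ?_ hdk (hdsum ▸ hsub)
    · rw [hdsum] at this
      have h := h2 _ hsub ψ hψΨ (by simpa using hmem) this
      simpa using h
    · intro v hv
      by_contra hvn
      have e1 : c v = 0 := by
        by_contra hne
        exact hvn (hc (by simpa using hne))
      have e2 : ψ ≠ v := fun h => hvn (h ▸ hψΨ)
      simp [hd, e1, Finsupp.single_apply, e2] at hv
    · intro v
      by_cases h : ψ = v
      · subst h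
        simp [hd]; omega
      · simpa [hd, Finsupp.single_apply, h] using hpos v

lemma rs_induct {V : Type*} [NormedAddCommGroup V] [InnerProductSpace ℝ V]
    [FiniteDimensional ℝ V] {S Ψ : Set V} (hS : IsRootSystem S) (hΨ : IsSimpleSystem S Ψ)
    (P : V → Prop) (h1 : ∀ ψ ∈ Ψ, P ψ)
    (h2 : ∀ α ∈ S, ∀ ψ ∈ Ψ, α + ψ ∈ S → P α → P (α + ψ))
    (h3 : ∀ α ∈ S, P α → P (-α)) (α : V) (hα : α ∈ S) : P α := by
  have key : ∀ (c : V →₀ ℤ), ↑c.support ⊆ Ψ → (∀ v, 0 ≤ c v) →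
      c.sum (fun v n => (n : ℝ) • v) ∈ S → P (c.sum (fun v n => (n : ℝ) • v)) := by
    intro c hc hp hm
    obtain ⟨k, hk⟩ := Int.eq_ofNat_of_zero_le
      (show 0 ≤ c.sum (fun _ n => n) from Finset.sum_nonneg fun v _ => hp v)
    exact rs_pos_induct hS hΨ P h1 h2 k c hc hp hk hm
  obtain ⟨c, hc, hsum, hp | hn⟩ := hΨ.2.2 α hα
  · rw [hsum]
    exact key c hc hp (hsum ▸ hα)
  · have hneg : (-c).sum (fun v n => (n : ℝ) • v) = -α := by
      rw [hsum, Finsupp.sum_neg_index (by simp), Finsupp.sum, Finsupp.sum, ← Finset.sum_neg_distrib]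
      simp
    have hm := rs_neg hS hα
    have := key (-c) (by simpa using hc) (fun v => by simpa using hn v) (hneg ▸ hm)
    rw [hneg] at this
    simpa using h3 _ hm this

lemma rs_four (z : ℂ) : z ^ 4 = 1 ↔ (z = 1 ∨ z = -1 ∨ z = Complex.I ∨ z = -Complex.I) := by
  constructor
  · intro h
    have : (z - 1) * ((z + 1) * ((z - Complex.I) * (z + Complex.I))) = 0 := by
      linear_combination h - (z ^ 2 - 1) * Complex.I_sq
    rcases mul_eq_zero.mp this with h | h
    · left; linear_combination h
    rcases mul_eq_zero.mp h with h | h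
    · right; left; linear_combination h
    rcases mul_eq_zero.mp h with h | h
    · right; right; left; linear_combination h
    · right; right; right; linear_combination h
  · rintro (rfl | rfl | rfl | rfl)
    · simp
    · norm_num
    · simp
    · rw [Even.neg_pow (by decide)]; simp

lemma rs_unique {V : Type*} [AddCommGroup V] [Module ℝ V] {Ψ : Set V}
    (hli : LinearIndependent ℝ (fun ψ : Ψ => (ψ : V))) (c d : V →₀ ℤ)
    (hc : ↑c.support ⊆ Ψ) (hd : ↑d.support ⊆ Ψ)
    (h : c.sum (fun v n => (n : ℝ) • v) = d.sum (fun v n => (n : ℝ) • v)) : c = d := by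
  have hl := linearIndepOn_iff.mp (show LinearIndepOn ℝ (id : V → V) Ψ from hli)
  have aux : ∀ e : V →₀ ℤ, Finsupp.linearCombination ℝ (id : V → V)
      (e.mapRange (Int.cast : ℤ → ℝ) (by simp)) = e.sum (fun v n => (n : ℝ) • v) := by
    intro e
    rw [Finsupp.linearCombination_apply, Finsupp.sum_mapRange_index (by simp)]
    rfl
  have mem : ∀ e : V →₀ ℤ, ↑e.support ⊆ Ψ →
      e.mapRange (Int.cast : ℤ → ℝ) (by simp) ∈ Finsupp.supported ℝ ℝ Ψ := by
    intro e he
    rw [Finsupp.mem_supported]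
    exact fun v hv => he (Finsupp.support_mapRange hv)
  have := hl _ (Submodule.sub_mem _ (mem c hc) (mem d hd)) (by rw [map_sub, aux, aux, h, sub_self])
  ext v
  have h2 := DFunLike.congr_fun this v
  simp only [Finsupp.sub_apply, Finsupp.mapRange_apply, Finsupp.zero_apply, sub_eq_zero] at h2
  exact_mod_cast h2

lemma rs_extend {V : Type*} [NormedAddCommGroup V] [InnerProductSpace ℝ V]
    [FiniteDimensional ℝ V] {S Ψ : Set V} (hΨ : IsSimpleSystem S Ψ)
    (f : Ψ → ℂ) (hf : ∀ ψ, f ψ ^ 4 = 1) :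
    ∃ ε : S → ℂ, IsHalfSignature S ε ∧ ∀ ψ : Ψ, ε ⟨(ψ : V), hΨ.1 ψ.2⟩ = f ψ := by
  classical
  choose c hc hsum _ using fun a : S => hΨ.2.2 a a.2
  let F : V → ℂ := fun v => if h : v ∈ Ψ then f ⟨v, h⟩ else 1
  have hF4 : ∀ v, F v ^ 4 = 1 := by
    intro v
    by_cases h : v ∈ Ψ
    · simp [F, h, hf]
    · simp [F, h]
  have hF0 : ∀ v, F v ≠ 0 := by
    intro v h
    have := hF4 v
    simp [h] at this
  have hadd : ∀ d e : V →₀ ℤ, (d + e).prod (fun v n => F v ^ n) =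
      d.prod (fun v n => F v ^ n) * e.prod (fun v n => F v ^ n) := fun d e =>
    Finsupp.prod_add_index' (by simp) (fun v m n => zpow_add₀ (hF0 v) m n)
  have hsadd : ∀ d e : V →₀ ℤ, (d + e).sum (fun v n => (n : ℝ) • v) =
      d.sum (fun v n => (n : ℝ) • v) + e.sum (fun v n => (n : ℝ) • v) := fun d e =>
    Finsupp.sum_add_index' (by simp) (by intros; push_cast; module)
  have hsupp : ∀ d e : V →₀ ℤ, ↑d.support ⊆ Ψ → ↑e.support ⊆ Ψ → ↑(d + e).support ⊆ Ψ := by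
    intro d e hd he v hv
    rcases Finset.mem_union.mp (Finsupp.support_add hv) with h | h
    · exact hd h
    · exact he h
  refine ⟨fun a => (c a).prod (fun v n => F v ^ n), ⟨?_, ?_, ?_⟩, ?_⟩
  · intro a
    rw [← rs_four]
    change (∏ v ∈ (c a).support, F v ^ (c a v)) ^ 4 = 1
    rw [← Finset.prod_pow]
    refine Finset.prod_eq_one fun v _ => ?_
    rw [← zpow_natCast, ← zpow_mul, mul_comm, zpow_mul]
    have : F v ^ ((4 : ℕ) : ℤ) = 1 := by rw [zpow_natCast]; exact hF4 v
    rw [this, one_zpow]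
  · intro a b hab
    have : c b + c a = 0 := by
      apply rs_unique hΨ.2.1 _ _ (hsupp _ _ (hc b) (hc a)) (by simp)
      rw [hsadd, ← hsum, ← hsum, hab]
      simp
    refine eq_inv_of_mul_eq_one_left ?_
    rw [← hadd, this]
    simp
  · intro a b d hd
    have : c d = c a + c b := by
      apply rs_unique hΨ.2.1 _ _ (hc d) (hsupp _ _ (hc a) (hc b))
      rw [hsadd, ← hsum, ← hsum, ← hsum, hd]
    simp only [this, hadd]
  · intro ψ
    have : c ⟨(ψ : V), hΨ.1 ψ.2⟩ = Finsupp.single (ψ : V) 1 := by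
      apply rs_unique hΨ.2.1 _ _ (hc _)
      · intro v hv
        have := Finsupp.support_single_subset hv
        simp at this
        exact this ▸ ψ.2
      · rw [← hsum]
        simp
    simp [this, F]

lemma rs_card_sq (x : ℝ) (hx : x = 1 ∨ x = -1) : Nat.card {z : ℂ // z ^ 2 = (x : ℂ)} = 2 := by
  have : ∃ w : ℂ, w ≠ 0 ∧ w ^ 2 = (x : ℂ) := by
    rcases hx with rfl | rfl
    · exact ⟨1, by simp, by simp⟩
    · exact ⟨Complex.I, by simp, by simp⟩
  obtain ⟨w, hw0, hw⟩ := this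
  have hset : {z : ℂ | z ^ 2 = (x : ℂ)} = {w, -w} := by
    ext z
    simp [← hw, sq_eq_sq_iff_eq_or_eq_neg]
  have : Nat.card {z : ℂ | z ^ 2 = (x : ℂ)} = 2 := by
    rw [hset, Nat.card_coe_set_eq, Set.ncard_pair]
    intro h
    exact hw0 (self_eq_neg.mp h)
  exact this

/-- For a (possibly non-reduced) root system `S` in a finite-dimensional
real vector space and a simple system `Ψ` of `S` with `r` elements:
(1) the restriction map `ε̂ ↦ ε̂|_Ψ` is a bijection from the set of half-signatures of `S`
onto the set of all maps `Ψ → {±1, ±√−1}`; and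
(2) for every signature `ε` of `S` there are exactly `2^r` half-signatures `ε̂` of `S` with
`ε̂² = ε` (pointwise square). -/
theorem statement16 {V : Type*} [NormedAddCommGroup V] [InnerProductSpace ℝ V]
    [FiniteDimensional ℝ V] (S Ψ : Set V) (hS : IsRootSystem S)
    (hΨ : IsSimpleSystem S Ψ) (r : ℕ) (hr : Ψ.ncard = r) :
    Function.Bijective
      (fun ε : {ε : S → ℂ // IsHalfSignature S ε} =>
        (⟨fun ψ : Ψ => ε.val ⟨(ψ : V), hΨ.1 ψ.2⟩, fun ψ => ε.prop.1 _⟩ :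
          {f : Ψ → ℂ // ∀ ψ, f ψ = 1 ∨ f ψ = -1 ∨ f ψ = Complex.I ∨ f ψ = -Complex.I})) ∧
    ∀ ε : S → ℝ, IsSignature S ε →
      Nat.card {εh : {εh : S → ℂ // IsHalfSignature S εh} //
        ∀ a : S, (εh.val a) ^ 2 = (ε a : ℂ)} = 2 ^ r := by
  have hext : ∀ f : Ψ → ℂ, (∀ ψ, f ψ ^ 4 = 1) →
      ∃ ε : S → ℂ, IsHalfSignature S ε ∧ ∀ ψ : Ψ, ε ⟨(ψ : V), hΨ.1 ψ.2⟩ = f ψ :=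
    fun f hf => rs_extend hΨ f hf
  have hinj : ∀ ε₁ ε₂ : S → ℂ, IsHalfSignature S ε₁ → IsHalfSignature S ε₂ →
      (∀ ψ : Ψ, ε₁ ⟨(ψ : V), hΨ.1 ψ.2⟩ = ε₂ ⟨(ψ : V), hΨ.1 ψ.2⟩) → ε₁ = ε₂ := by
    intro ε₁ ε₂ h₁ h₂ h
    funext a
    refine rs_induct hS hΨ (fun v => ∀ hv : v ∈ S, ε₁ ⟨v, hv⟩ = ε₂ ⟨v, hv⟩) ?_ ?_ ?_ a a.2 a.2
    · exact fun ψ hψ _ => h ⟨ψ, hψ⟩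
    · intro α hα ψ hψ _ ih hv
      rw [h₁.2.2 ⟨α, hα⟩ ⟨ψ, hΨ.1 hψ⟩ _ rfl, h₂.2.2 ⟨α, hα⟩ ⟨ψ, hΨ.1 hψ⟩ _ rfl, ih hα,
        h ⟨ψ, hψ⟩]
    · intro α hα ih hv
      rw [h₁.2.1 ⟨α, hα⟩ _ rfl, h₂.2.1 ⟨α, hα⟩ _ rfl, ih hα]
  refine ⟨⟨?_, ?_⟩, ?_⟩
  · rintro ⟨ε₁, h₁⟩ ⟨ε₂, h₂⟩ h
    exact Subtype.ext (hinj _ _ h₁ h₂ fun ψ => congrFun (congrArg Subtype.val h) ψ)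
  · rintro ⟨f, hf⟩
    obtain ⟨ε, hε, h⟩ := hext f (fun ψ => (rs_four _).mpr (hf ψ))
    exact ⟨⟨ε, hε⟩, Subtype.ext (funext h)⟩
  · intro ε hε
    have hfin : Finite Ψ := (hS.1.subset hΨ.1).to_subtype
    have := Fintype.ofFinite Ψ
    let T : {εh : {εh : S → ℂ // IsHalfSignature S εh} // ∀ a : S, (εh.val a) ^ 2 = (ε a : ℂ)} →
        (∀ ψ : Ψ, {z : ℂ // z ^ 2 = (ε ⟨(ψ : V), hΨ.1 ψ.2⟩ : ℂ)}) :=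
      fun e ψ => ⟨e.1.1 ⟨(ψ : V), hΨ.1 ψ.2⟩, e.2 _⟩
    have hT : Function.Bijective T := by
      constructor
      · rintro ⟨⟨ε₁, h₁⟩, k₁⟩ ⟨⟨ε₂, h₂⟩, k₂⟩ h
        exact Subtype.ext (Subtype.ext (hinj _ _ h₁ h₂ fun ψ =>
          congrArg Subtype.val (congrFun h ψ)))
      · intro g
        obtain ⟨e, he, h⟩ := hext (fun ψ => (g ψ).1) (fun ψ => by
          rw [show (4 : ℕ) = 2 * 2 from rfl, pow_mul, (g ψ).2]
          rcases hε.1 ⟨(ψ : V), hΨ.1 ψ.2⟩ with h | h <;> rw [h] <;> simp)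
        refine ⟨⟨⟨e, he⟩, fun a => ?_⟩, funext fun ψ => Subtype.ext (h ψ)⟩
        refine rs_induct hS hΨ (fun v => ∀ hv : v ∈ S, (e ⟨v, hv⟩) ^ 2 = (ε ⟨v, hv⟩ : ℂ))
          ?_ ?_ ?_ a a.2 a.2
        · intro ψ hψ _
          rw [h ⟨ψ, hψ⟩]
          exact (g ⟨ψ, hψ⟩).2
        · intro α hα ψ hψ _ ih hv
          rw [he.2.2 ⟨α, hα⟩ ⟨ψ, hΨ.1 hψ⟩ _ rfl, hε.2.2 ⟨α, hα⟩ ⟨ψ, hΨ.1 hψ⟩ _ rfl, mul_pow,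
            ih hα, h ⟨ψ, hψ⟩, (g ⟨ψ, hψ⟩).2]
          push_cast
          rfl
        · intro α hα ih hv
          rw [he.2.1 ⟨α, hα⟩ _ rfl, hε.2.1 ⟨α, hα⟩ _ rfl, inv_pow, ih hα]
          rcases hε.1 ⟨α, hα⟩ with h | h <;> rw [h] <;> norm_num
    rw [Nat.card_congr (Equiv.ofBijective T hT), Nat.card_pi,
      Finset.prod_congr rfl (fun (ψ : Ψ) _ => rs_card_sq _ (hε.1 ⟨(ψ : V), hΨ.1 ψ.2⟩))]
    rw [Finset.prod_const, Finset.card_univ, ← hr, ← Nat.card_coe_set_eq, Nat.card_eq_fintype_card]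
end
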